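/- arXiv:math/0106107 — 2 statements merged into one kernel-verified Lean document; each statement's English description precedes it below -/
import Mathlib

section
/- Let E₁ and E₂ be Banach spaces over 𝕜 and let 𝒜₁ ⊆ B(E₁) and 𝒜₂ ⊆ B(E₂) be standard subalgebras. If T : 𝒜₁ → 𝒜₂ is a biseparating linear bijection, then T is continuous with respect to the operator norms, and there exist a continuous linear isomorphism S : E₁ → E₂ with continuous inverse and a nonzero scalar α ∈ 𝕜 such that T(A) = α · (S ∘ A ∘ S⁻¹) for every A ∈ 𝒜₁. -/
set_option synthInstance.maxHeartbeats 400000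
set_option maxHeartbeats 1000000

/-- A subalgebra of `B(E)` is *standard* if it contains every continuous finite-rank
operator (it contains the identity automatically, being a subalgebra). -/
def IsStandardSubalgebra (𝕜 : Type*) [RCLike 𝕜] {E : Type*} [NormedAddCommGroup E]
    [NormedSpace 𝕜 E] (𝒜 : Subalgebra 𝕜 (E →L[𝕜] E)) : Prop :=
  ∀ A : E →L[𝕜] E, FiniteDimensional 𝕜 (LinearMap.range (A : E →ₗ[𝕜] E)) → A ∈ 𝒜

namespace Bisep

variable {𝕜 : Type*} [RCLike 𝕜] {E E₁ E₂ : Type*}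
  [NormedAddCommGroup E] [NormedSpace 𝕜 E]
  [NormedAddCommGroup E₁] [NormedSpace 𝕜 E₁]
  [NormedAddCommGroup E₂] [NormedSpace 𝕜 E₂]

/-- The rank-one operator `z ↦ f z • x` as an element of a standard subalgebra. -/
noncomputable def rk {𝒜 : Subalgebra 𝕜 (E →L[𝕜] E)} (h : IsStandardSubalgebra 𝕜 𝒜)
    (f : E →L[𝕜] 𝕜) (x : E) : 𝒜 :=
  ⟨f.smulRight x, h _ (by
    refine Submodule.finiteDimensional_of_le (S₂ := Submodule.span 𝕜 {x}) ?_
    rintro _ ⟨z, rfl⟩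
    exact Submodule.smul_mem _ _ (Submodule.mem_span_singleton_self x))⟩

theorem rk_apply {𝒜 : Subalgebra 𝕜 (E →L[𝕜] E)} (h : IsStandardSubalgebra 𝕜 𝒜)
    (f : E →L[𝕜] 𝕜) (x z : E) : (rk h f x : E →L[𝕜] E) z = f z • x := rfl

theorem ext' {𝒜 : Subalgebra 𝕜 (E →L[𝕜] E)} {a b : 𝒜}
    (h : ∀ z, (a : E →L[𝕜] E) z = (b : E →L[𝕜] E) z) : a = b :=
  Subtype.ext (ContinuousLinearMap.ext h)

theorem mul_app {𝒜 : Subalgebra 𝕜 (E →L[𝕜] E)} (a b : 𝒜) (z : E) :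
    ((a * b : 𝒜) : E →L[𝕜] E) z = (a : E →L[𝕜] E) ((b : E →L[𝕜] E) z) := rfl

theorem add_app {𝒜 : Subalgebra 𝕜 (E →L[𝕜] E)} (a b : 𝒜) (z : E) :
    ((a + b : 𝒜) : E →L[𝕜] E) z = (a : E →L[𝕜] E) z + (b : E →L[𝕜] E) z := rfl

theorem sub_app {𝒜 : Subalgebra 𝕜 (E →L[𝕜] E)} (a b : 𝒜) (z : E) :
    ((a - b : 𝒜) : E →L[𝕜] E) z = (a : E →L[𝕜] E) z - (b : E →L[𝕜] E) z := rfl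

theorem smul_app {𝒜 : Subalgebra 𝕜 (E →L[𝕜] E)} (c : 𝕜) (b : 𝒜) (z : E) :
    ((c • b : 𝒜) : E →L[𝕜] E) z = c • (b : E →L[𝕜] E) z := rfl

theorem zero_app {𝒜 : Subalgebra 𝕜 (E →L[𝕜] E)} (z : E) :
    ((0 : 𝒜) : E →L[𝕜] E) z = 0 := rfl

/-- Annihilator inclusion gives kernel inclusion. -/
theorem ker_of_ann {𝒜 : Subalgebra 𝕜 (E →L[𝕜] E)} (h : IsStandardSubalgebra 𝕜 𝒜)
    {a b : 𝒜} (hab : ∀ c : 𝒜, a * c = 0 → b * c = 0) (z : E)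
    (hz : (a : E →L[𝕜] E) z = 0) : (b : E →L[𝕜] E) z = 0 := by
  by_cases hz0 : z = 0
  · simp [hz0]
  obtain ⟨f, hf⟩ := SeparatingDual.exists_eq_one (R := 𝕜) hz0
  have h1 := hab (rk h f z) (ext' fun w => by
    rw [mul_app, rk_apply, map_smul, hz, smul_zero, zero_app])
  have h2 : ((b * rk h f z : 𝒜) : E →L[𝕜] E) z = 0 := by rw [h1, zero_app]
  rwa [mul_app, rk_apply, hf, one_smul] at h2

theorem ann_of_ker {𝒜 : Subalgebra 𝕜 (E →L[𝕜] E)}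
    {a b : 𝒜} (hab : ∀ z : E, (a : E →L[𝕜] E) z = 0 → (b : E →L[𝕜] E) z = 0) (c : 𝒜)
    (hc : a * c = 0) : b * c = 0 := by
  refine ext' fun z => ?_
  rw [mul_app, zero_app]
  apply hab
  rw [← mul_app, hc, zero_app]

section
variable {𝒜₁ : Subalgebra 𝕜 (E₁ →L[𝕜] E₁)} {𝒜₂ : Subalgebra 𝕜 (E₂ →L[𝕜] E₂)}

theorem idem (T : 𝒜₁ →ₗ[𝕜] 𝒜₂)
    (hsep : ∀ a b : 𝒜₁, a * b = 0 → T a * T b = 0)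
    (p : 𝒜₁) (hp : p * p = p) (a c : 𝒜₁) : T (a * p) * T c = T a * T (p * c) := by
  have h1 := hsep (a * p) (c - p * c) (by
    rw [mul_sub, mul_assoc a p (p * c), ← mul_assoc p p c, hp, ← mul_assoc, sub_self])
  have h2 := hsep (a - a * p) (p * c) (by
    rw [sub_mul, mul_assoc a p (p * c), ← mul_assoc p p c, hp, sub_self])
  rw [map_sub, mul_sub, sub_eq_zero] at h1
  rw [map_sub, sub_mul, sub_eq_zero] at h2
  rw [h1, h2]

theorem rk_move (h𝒜₁ : IsStandardSubalgebra 𝕜 𝒜₁)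
    (T : 𝒜₁ →ₗ[𝕜] 𝒜₂)
    (hsep : ∀ a b : 𝒜₁, a * b = 0 → T a * T b = 0)
    (f : E₁ →L[𝕜] 𝕜) (x : E₁) (a c : 𝒜₁) :
    T (a * rk h𝒜₁ f x) * T c = T a * T (rk h𝒜₁ f x * c) := by
  have key : ∀ f : E₁ →L[𝕜] 𝕜, f x = 1 →
      T (a * rk h𝒜₁ f x) * T c = T a * T (rk h𝒜₁ f x * c) := by
    intro f hf
    apply idem T hsep
    refine ext' fun z => ?_
    simp only [mul_app, rk_apply, map_smul, hf, one_smul]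
  by_cases hx : x = 0
  · have : rk h𝒜₁ f x = 0 := ext' fun z => by rw [rk_apply, hx, smul_zero, zero_app]
    rw [this]; simp
  obtain ⟨g, hg⟩ := SeparatingDual.exists_eq_one (R := 𝕜) hx
  by_cases hf : f x = 0
  · have e : rk h𝒜₁ f x = rk h𝒜₁ (f + g) x - rk h𝒜₁ g x := ext' fun z => by
      rw [sub_app, rk_apply, rk_apply, rk_apply, add_apply, add_smul]
      simp
    have k1 := key (f + g) (by rw [add_apply, hf, hg, zero_add])
    have k2 := key g hg
    rw [e, mul_sub, sub_mul, map_sub, map_sub, sub_mul, mul_sub, k1, k2]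
  · have e : rk h𝒜₁ f x = f x • rk h𝒜₁ ((f x)⁻¹ • f) x := ext' fun z => by
      rw [smul_app, rk_apply, rk_apply, smul_smul, smul_apply, smul_eq_mul,
        mul_inv_cancel_left₀ hf]
    have k1 := key ((f x)⁻¹ • f) (by
      rw [smul_apply, smul_eq_mul, inv_mul_cancel₀ hf])
    rw [e, mul_smul_comm, smul_mul_assoc, map_smul, map_smul, smul_mul_assoc, mul_smul_comm, k1]

/-- The preimage of a rank-one operator is a rank-one operator. -/
theorem preimage_rk (h𝒜₁ : IsStandardSubalgebra 𝕜 𝒜₁) (h𝒜₂ : IsStandardSubalgebra 𝕜 𝒜₂)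
    (T : 𝒜₁ →ₗ[𝕜] 𝒜₂) (hbij : Function.Bijective T)
    (hsep : ∀ a b : 𝒜₁, a * b = 0 → T a * T b = 0)
    (hsep' : ∀ a b : 𝒜₁, T a * T b = 0 → a * b = 0)
    (g : E₂ →L[𝕜] 𝕜) (y : E₂) :
    ∃ (f : E₁ →L[𝕜] 𝕜) (x : E₁), T (rk h𝒜₁ f x) = rk h𝒜₂ g y := by
  obtain ⟨b, hb⟩ := hbij.2 (rk h𝒜₂ g y)
  suffices ∃ (f : E₁ →L[𝕜] 𝕜) (x : E₁), b = rk h𝒜₁ f x by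
    obtain ⟨f, x, h⟩ := this
    exact ⟨f, x, by rw [← h, hb]⟩
  by_cases hb0 : ∀ z, (b : E₁ →L[𝕜] E₁) z = 0
  · exact ⟨0, 0, ext' fun z => by rw [hb0, rk_apply, smul_zero]⟩
  push Not at hb0
  obtain ⟨z1, hz1⟩ := hb0
  obtain ⟨φ, hφ⟩ := SeparatingDual.exists_eq_one (R := 𝕜) hz1
  set x := (b : E₁ →L[𝕜] E₁) z1 with hx
  set f : E₁ →L[𝕜] 𝕜 := φ ∘L (b : E₁ →L[𝕜] E₁) with hf
  have hfa : ∀ z, f z = φ ((b : E₁ →L[𝕜] E₁) z) := fun z => rfl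
  set a := rk h𝒜₁ f x with ha
  have h1 : ∀ z, (b : E₁ →L[𝕜] E₁) z = 0 → (a : E₁ →L[𝕜] E₁) z = 0 := fun z hz => by
    rw [ha, rk_apply, hfa, hz, map_zero, zero_smul]
  have h2 : ∀ w, (T b : E₂ →L[𝕜] E₂) w = 0 → (T a : E₂ →L[𝕜] E₂) w = 0 := by
    apply ker_of_ann h𝒜₂
    intro c hc
    obtain ⟨c, rfl⟩ := hbij.2 c
    exact hsep _ _ (ann_of_ker h1 c (hsep' _ _ hc))
  have hTa : T a ≠ 0 := by
    intro h0
    have : a = 0 := hbij.1 (by rw [h0, map_zero])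
    have h3 : (a : E₁ →L[𝕜] E₁) z1 = 0 := by rw [this, zero_app]
    rw [ha, rk_apply, hfa, hφ, one_smul] at h3
    exact hz1 h3
  have h3 : ∀ w, (T a : E₂ →L[𝕜] E₂) w = 0 → (T b : E₂ →L[𝕜] E₂) w = 0 := by
    intro w hw
    rw [hb, rk_apply]
    by_contra hne
    have hgw : g w ≠ 0 := fun h => hne (by rw [h, zero_smul])
    apply hTa
    refine ext' fun v => ?_
    have h4 := h2 (v - (g v * (g w)⁻¹) • w) (by
      rw [hb, rk_apply, map_sub, map_smul, smul_eq_mul, inv_mul_cancel_right₀ hgw, sub_self,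
        zero_smul])
    rw [map_sub, map_smul, hw, smul_zero, sub_zero] at h4
    rw [h4, zero_app]
  have h5 : ∀ w, (a : E₁ →L[𝕜] E₁) w = 0 → (b : E₁ →L[𝕜] E₁) w = 0 := by
    apply ker_of_ann h𝒜₁
    intro c hc
    exact hsep' _ _ (ann_of_ker h3 _ (hsep _ _ hc))
  refine ⟨f, x, ext' fun z => ?_⟩
  have h6 := h5 (z - f z • z1) (by
    rw [ha, rk_apply, map_sub, map_smul, hfa z1, hφ, smul_eq_mul, mul_one, sub_self, zero_smul])
  rw [map_sub, map_smul, sub_eq_zero] at h6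
  rw [h6, rk_apply]

theorem T_one [Nontrivial E₂] (h𝒜₁ : IsStandardSubalgebra 𝕜 𝒜₁) (h𝒜₂ : IsStandardSubalgebra 𝕜 𝒜₂)
    (T : 𝒜₁ →ₗ[𝕜] 𝒜₂) (hbij : Function.Bijective T)
    (hsep : ∀ a b : 𝒜₁, a * b = 0 → T a * T b = 0)
    (hsep' : ∀ a b : 𝒜₁, T a * T b = 0 → a * b = 0) : ∃ α : 𝕜, α ≠ 0 ∧ T 1 = α • 1 := by
  obtain ⟨z, hz⟩ := exists_ne (0 : E₂)
  obtain ⟨g, hg⟩ := SeparatingDual.exists_eq_one (R := 𝕜) hz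
  have hT : T 1 = (g ((T 1 : E₂ →L[𝕜] E₂) z)) • (1 : 𝒜₂) := by
    refine ext' fun y => ?_
    obtain ⟨f, x, hfx⟩ := preimage_rk h𝒜₁ h𝒜₂ T hbij hsep hsep' g y
    have h := rk_move h𝒜₁ T hsep f x 1 1
    rw [one_mul, mul_one, hfx] at h
    have h' := congrArg (fun u : 𝒜₂ => (u : E₂ →L[𝕜] E₂) z) h
    simp only [mul_app, rk_apply, hg, one_smul] at h'
    rw [← h', smul_app]
    rfl
  refine ⟨_, ?_, hT⟩
  intro h0
  rw [h0, zero_smul] at hT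
  have h1 : (1 : 𝒜₁) = 0 := hbij.1 (by rw [hT, map_zero])
  obtain ⟨c, hc⟩ := hbij.2 (1 : 𝒜₂)
  have h2 : c = 0 := by rw [← mul_one c, h1, mul_zero]
  rw [h2, map_zero] at hc
  apply hz
  have := congrArg (fun u : 𝒜₂ => (u : E₂ →L[𝕜] E₂) z) hc
  exact this.symm

end

end Bisep

theorem biseparating_on_standard_subalgebras_is_standard
    {𝕜 : Type*} [RCLike 𝕜]
    {E₁ E₂ : Type*} [NormedAddCommGroup E₁] [NormedSpace 𝕜 E₁] [CompleteSpace E₁]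
    [NormedAddCommGroup E₂] [NormedSpace 𝕜 E₂] [CompleteSpace E₂]
    (𝒜₁ : Subalgebra 𝕜 (E₁ →L[𝕜] E₁)) (𝒜₂ : Subalgebra 𝕜 (E₂ →L[𝕜] E₂))
    (h𝒜₁ : IsStandardSubalgebra 𝕜 𝒜₁) (h𝒜₂ : IsStandardSubalgebra 𝕜 𝒜₂)
    (T : 𝒜₁ →ₗ[𝕜] 𝒜₂) (hbij : Function.Bijective T)
    (hsep : ∀ a b : 𝒜₁, a * b = 0 → T a * T b = 0)
    (hsep' : ∀ a b : 𝒜₁, T a * T b = 0 → a * b = 0) :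
    Continuous T ∧
      ∃ (S : E₁ ≃L[𝕜] E₂) (α : 𝕜), α ≠ 0 ∧
        ∀ A : 𝒜₁, ((T A : E₂ →L[𝕜] E₂)) =
          α • ((S : E₁ →L[𝕜] E₂) ∘L (A : E₁ →L[𝕜] E₁) ∘L (S.symm : E₂ →L[𝕜] E₁)) := by
  suffices H : ∃ (S : E₁ ≃L[𝕜] E₂) (α : 𝕜), α ≠ 0 ∧
        ∀ A : 𝒜₁, ((T A : E₂ →L[𝕜] E₂)) =
          α • ((S : E₁ →L[𝕜] E₂) ∘L (A : E₁ →L[𝕜] E₁) ∘L (S.symm : E₂ →L[𝕜] E₁)) by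
    refine ⟨?_, H⟩
    obtain ⟨S, α, -, hS⟩ := H
    refine continuous_induced_rng.2 ?_
    have : (Subtype.val ∘ T : 𝒜₁ → (E₂ →L[𝕜] E₂)) = fun A : 𝒜₁ =>
        α • ((S : E₁ →L[𝕜] E₂) ∘L (A : E₁ →L[𝕜] E₁) ∘L (S.symm : E₂ →L[𝕜] E₁)) :=
      funext hS
    rw [this]
    exact (continuous_const.clm_comp
      (continuous_subtype_val.clm_comp continuous_const)).const_smul α
  rcases subsingleton_or_nontrivial E₁ with hE | hE
  · have hs2 : Subsingleton E₂ := by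
      refine subsingleton_of_forall_eq 0 fun z => ?_
      obtain ⟨c, hc⟩ := hbij.2 (1 : 𝒜₂)
      have h2 : c = 0 := Bisep.ext' fun z => Subsingleton.elim _ _
      rw [h2, map_zero] at hc
      exact (congrArg (fun u : 𝒜₂ => (u : E₂ →L[𝕜] E₂) z) hc).symm
    exact ⟨ContinuousLinearEquiv.equivOfInverse 0 0 (fun _ => Subsingleton.elim _ _)
      (fun _ => Subsingleton.elim _ _), 1, one_ne_zero,
      fun A => ContinuousLinearMap.ext fun z => Subsingleton.elim _ _⟩
  obtain ⟨x0, hx0⟩ := exists_ne (0 : E₁)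
  obtain ⟨f0, hf0⟩ := SeparatingDual.exists_eq_one (R := 𝕜) hx0
  let p : 𝒜₁ := Bisep.rk h𝒜₁ f0 x0
  have hp : (p : E₁ →L[𝕜] E₁) x0 = x0 := by
    change f0 x0 • x0 = x0
    rw [hf0, one_smul]
  have hTp : ∃ y, (T p : E₂ →L[𝕜] E₂) y ≠ 0 := by
    by_contra! h
    have h0 : p = 0 := hbij.1 (by rw [map_zero]; exact Bisep.ext' h)
    apply hx0
    rw [← hp, h0]
    rfl
  obtain ⟨y1, hy1⟩ := hTp
  have : Nontrivial E₂ := ⟨_, _, hy1⟩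
  obtain ⟨α, hα, hT1⟩ := Bisep.T_one h𝒜₁ h𝒜₂ T hbij hsep hsep'
  -- multiplicativity
  have hmul : ∀ (a : 𝒜₁) (f : E₁ →L[𝕜] 𝕜) (x : E₁) (w : E₂),
      (T a : E₂ →L[𝕜] E₂) ((T (Bisep.rk h𝒜₁ f x) : E₂ →L[𝕜] E₂) w) =
        α • (T (Bisep.rk h𝒜₁ f ((a : E₁ →L[𝕜] E₁) x)) : E₂ →L[𝕜] E₂) w := by
    intro a f x w
    have h := Bisep.rk_move h𝒜₁ T hsep f x a 1
    have e : a * Bisep.rk h𝒜₁ f x = Bisep.rk h𝒜₁ f ((a : E₁ →L[𝕜] E₁) x) :=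
      Bisep.ext' fun z => by rw [Bisep.mul_app, Bisep.rk_apply, Bisep.rk_apply, map_smul]
    rw [mul_one, e, hT1, mul_smul_comm, mul_one] at h
    rw [← Bisep.mul_app, ← h, Bisep.smul_app]
  let y0 : E₂ := (T p : E₂ →L[𝕜] E₂) y1
  let S0 : E₁ →ₗ[𝕜] E₂ :=
    { toFun := fun x => (T (Bisep.rk h𝒜₁ f0 x) : E₂ →L[𝕜] E₂) y1
      map_add' := fun x x' => by
        have : Bisep.rk h𝒜₁ f0 (x + x') = Bisep.rk h𝒜₁ f0 x + Bisep.rk h𝒜₁ f0 x' :=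
          Bisep.ext' fun z => by
            simp only [Bisep.add_app, Bisep.rk_apply, smul_add]
        rw [this, map_add, Bisep.add_app]
      map_smul' := fun c x => by
        have : Bisep.rk h𝒜₁ f0 (c • x) = c • Bisep.rk h𝒜₁ f0 x :=
          Bisep.ext' fun z => by
            simp only [Bisep.smul_app, Bisep.rk_apply]
            rw [smul_comm]
        rw [this, map_smul, Bisep.smul_app, RingHom.id_apply] }
  have hS : ∀ (a : 𝒜₁) (x : E₁),
      (T a : E₂ →L[𝕜] E₂) (S0 x) = α • S0 ((a : E₁ →L[𝕜] E₁) x) :=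
    fun a x => hmul a f0 x y1
  have hS0 : S0 x0 ≠ 0 := hy1
  have hinj : ∀ x, S0 x = 0 → x = 0 := by
    intro x hx
    by_contra hne
    obtain ⟨f, hf⟩ := SeparatingDual.exists_eq_one (R := 𝕜) hne
    have h := hS (Bisep.rk h𝒜₁ f x0) x
    rw [hx, map_zero, Bisep.rk_apply, hf, one_smul] at h
    exact smul_ne_zero hα hS0 h.symm
  have hsurj : Function.Surjective S0 := by
    intro y
    obtain ⟨g, hg⟩ := SeparatingDual.exists_eq_one (R := 𝕜) hS0
    obtain ⟨c, hc⟩ := hbij.2 (Bisep.rk h𝒜₂ g y)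
    have h := hS c x0
    rw [hc, Bisep.rk_apply, hg, one_smul] at h
    exact ⟨α • (c : E₁ →L[𝕜] E₁) x0, by rw [map_smul, h]⟩
  have hcont : Continuous S0 := by
    apply LinearMap.continuous_of_seq_closed_graph
    intro u x y hu hSu
    obtain ⟨x', rfl⟩ := hsurj y
    suffices x' - x = 0 by rw [sub_eq_zero.1 this]
    by_contra hne
    obtain ⟨f, hf⟩ := SeparatingDual.exists_eq_one (R := 𝕜) hne
    let c := Bisep.rk h𝒜₁ f x0
    have l1 : Filter.Tendsto (fun n => (T c : E₂ →L[𝕜] E₂) (S0 (u n))) Filter.atTop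
        (nhds ((T c : E₂ →L[𝕜] E₂) (S0 x'))) :=
      ((T c : E₂ →L[𝕜] E₂).continuous.tendsto _).comp hSu
    have e : ∀ v, (T c : E₂ →L[𝕜] E₂) (S0 v) = α • f v • S0 x0 := fun v => by
      rw [hS, Bisep.rk_apply, map_smul]
    have l2 : Filter.Tendsto (fun n => (T c : E₂ →L[𝕜] E₂) (S0 (u n))) Filter.atTop
        (nhds (α • f x • S0 x0)) := by
      simp only [e]
      exact (((f.continuous.tendsto x).comp hu).smul_const _).const_smul α
    have h := tendsto_nhds_unique l1 l2
    rw [e] at h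
    have h' : α • f (x' - x) • S0 x0 = 0 := by
      rw [map_sub, sub_smul, smul_sub, h, sub_self]
    rw [hf, one_smul] at h'
    exact smul_ne_zero hα hS0 h'
  let S1 : E₁ →L[𝕜] E₂ := ⟨S0, hcont⟩
  let S : E₁ ≃L[𝕜] E₂ := ContinuousLinearEquiv.ofBijective S1
    (LinearMap.ker_eq_bot'.2 hinj) (LinearMap.range_eq_top.2 hsurj)
  refine ⟨S, α, hα, fun A => ContinuousLinearMap.ext fun z => ?_⟩
  obtain ⟨x, rfl⟩ := S.surjective z
  have h := hS A x
  have e : (α • ((S : E₁ →L[𝕜] E₂) ∘L (A : E₁ →L[𝕜] E₁) ∘L (S.symm : E₂ →L[𝕜] E₁))) (S x) =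
      α • S ((A : E₁ →L[𝕜] E₁) x) := by simp
  rw [e]
  exact h
end

section
/- Let X₁, X₂ be completely regular Hausdorff spaces, E₁, E₂ nonzero Banach spaces over 𝕜, 𝒜₁ ⊆ B(E₁) and 𝒜₂ ⊆ B(E₂) standard subalgebras, and let T : C(X₁, 𝒜₁) → C(X₂, 𝒜₂) be a biseparating linear bijection. Then T is strictly biseparating: for all F₁, F₂ ∈ C(X₁, 𝒜₁), c(F₁) ∩ c(F₂) = ∅ if and only if c(T(F₁)) ∩ c(T(F₂)) = ∅. -/
set_option synthInstance.maxHeartbeats 400000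
set_option maxHeartbeats 1000000

/-- Scalar multiplication by elements of `𝕜` is continuous on a subalgebra of `B(E)`
(a shortcut instance; it is derivable in Mathlib but the search is very slow). -/
instance {𝕜 : Type*} [RCLike 𝕜] {E : Type*} [NormedAddCommGroup E] [NormedSpace 𝕜 E]
    (𝒜 : Subalgebra 𝕜 (E →L[𝕜] E)) : ContinuousConstSMul 𝕜 𝒜 :=
  ⟨fun c => (((continuous_const_smul c).comp continuous_subtype_val).subtype_mk _)⟩

theorem mul_sub_aux {𝕜 R : Type*} [Field 𝕜] [Ring R] [Algebra 𝕜 R] (a b c : R) :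
    a * (b + (-1 : 𝕜) • c) = 0 ↔ a * b = a * c := by
  rw [neg_one_smul, mul_add, mul_neg, add_neg_eq_zero]

theorem sub_mul_aux {𝕜 R : Type*} [Field 𝕜] [Ring R] [Algebra 𝕜 R] (a b c : R) :
    (a + (-1 : 𝕜) • b) * c = 0 ↔ a * c = b * c := by
  rw [neg_one_smul, add_mul, neg_mul, add_neg_eq_zero]

theorem disjoint_map_aux
    {𝕜 : Type*} [RCLike 𝕜]
    {E₁ E₂ : Type*} [NormedAddCommGroup E₁] [NormedSpace 𝕜 E₁]
    [NormedAddCommGroup E₂] [NormedSpace 𝕜 E₂]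
    (𝒜₁ : Subalgebra 𝕜 (E₁ →L[𝕜] E₁)) (𝒜₂ : Subalgebra 𝕜 (E₂ →L[𝕜] E₂))
    (h𝒜₂ : IsStandardSubalgebra 𝕜 𝒜₂)
    {X₁ X₂ : Type*} [TopologicalSpace X₁] [TopologicalSpace X₂]
    (T : C(X₁, 𝒜₁) →ₗ[𝕜] C(X₂, 𝒜₂)) (hsurj : Function.Surjective T)
    (hsep : ∀ F G : C(X₁, 𝒜₁), F * G = 0 → T F * T G = 0)
    (hsep' : ∀ F G : C(X₁, 𝒜₁), T F * T G = 0 → F * G = 0)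
    (F G : C(X₁, 𝒜₁)) (h : ∀ x, F x = 0 ∨ G x = 0) (y : X₂) :
    T F y = 0 ∨ T G y = 0 := by
  have key : ∀ B : C(X₂, 𝒜₂), B * B = B → T F * B * T G = 0 := by
    intro B hB
    obtain ⟨K, hK⟩ := hsurj (T F * B)
    obtain ⟨L, hL⟩ := hsurj (B * T G)
    have hBx : ∀ t, B t * B t = B t := fun t => DFunLike.congr_fun hB t
    have h1' : K * (G + (-1 : 𝕜) • L) = 0 := by
      apply hsep'
      rw [T.map_add, T.map_smul, hK, hL]
      ext1 t
      change (T F t * B t) * (T G t + (-1 : 𝕜) • (B t * T G t)) = 0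
      refine (mul_sub_aux _ _ _).2 ?_
      rw [mul_assoc, mul_assoc, ← mul_assoc (B t) (B t), hBx]
    have h2' : (F + (-1 : 𝕜) • K) * L = 0 := by
      apply hsep'
      rw [T.map_add, T.map_smul, hK, hL]
      ext1 t
      change (T F t + (-1 : 𝕜) • (T F t * B t)) * (B t * T G t) = 0
      refine (sub_mul_aux _ _ _).2 ?_
      rw [mul_assoc, ← mul_assoc (B t) (B t), hBx]
    have h1 : K * G = K * L := by
      ext1 t
      have := DFunLike.congr_fun h1' t
      change K t * (G t + (-1 : 𝕜) • L t) = 0 at this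
      exact (mul_sub_aux _ _ _).1 this
    have h2 : F * L = K * L := by
      ext1 t
      have := DFunLike.congr_fun h2' t
      change (F t + (-1 : 𝕜) • K t) * L t = 0 at this
      exact (sub_mul_aux _ _ _).1 this
    have h3 : K * G = 0 := by
      ext1 x
      rcases h x with hx | hx
      · rw [h1, ← h2, ContinuousMap.mul_apply, hx, zero_mul, ContinuousMap.zero_apply]
      · rw [ContinuousMap.mul_apply, hx, mul_zero, ContinuousMap.zero_apply]
    rw [← hK]
    exact hsep _ _ h3
  by_contra! hc
  obtain ⟨hF, hG⟩ := hc
  have ex : ∀ A : 𝒜₂, A ≠ 0 → ∃ u, (A : E₂ →L[𝕜] E₂) u ≠ 0 := by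
    intro A hA
    by_contra! hu
    exact hA (Subtype.ext (ContinuousLinearMap.ext hu))
  obtain ⟨u, hu⟩ := ex _ hF
  obtain ⟨v, hv⟩ := ex _ hG
  set w := (T G y : E₂ →L[𝕜] E₂) v with hw
  obtain ⟨f, hf⟩ : ∃ f : StrongDual 𝕜 E₂, f w = 1 := by
    obtain ⟨g, -, hg⟩ := exists_dual_vector 𝕜 w (norm_ne_zero_iff.2 hv)
    have hn : ((‖w‖ : ℝ) : 𝕜) ≠ 0 := by simpa using hv
    refine ⟨((‖w‖ : ℝ) : 𝕜)⁻¹ • g, ?_⟩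
    simp only [smul_apply, hg, smul_eq_mul]
    exact inv_mul_cancel₀ hn
  obtain ⟨x, hx, hFx⟩ : ∃ x, f x = 1 ∧ (T F y : E₂ →L[𝕜] E₂) x ≠ 0 := by
    by_cases hFw : (T F y : E₂ →L[𝕜] E₂) w = 0
    · refine ⟨u + (1 - f u) • w, ?_, ?_⟩
      · simp [hf]
      · simpa [hFw] using hu
    · exact ⟨w, hf, hFw⟩
  have hBmem : f.smulRight x ∈ 𝒜₂ := by
    apply h𝒜₂
    refine Submodule.finiteDimensional_of_le (S₂ := Submodule.span 𝕜 {x}) ?_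
    rintro _ ⟨z, rfl⟩
    exact Submodule.smul_mem _ _ (Submodule.mem_span_singleton_self x)
  have hz := key (ContinuousMap.const X₂ ⟨f.smulRight x, hBmem⟩) (by
    ext1 t
    apply Subtype.ext
    ext z
    simp [hx])
  have hz' := congrArg (fun A : 𝒜₂ => (A : E₂ →L[𝕜] E₂) v) (DFunLike.congr_fun hz y)
  apply hFx
  simpa [← hw, hf] using hz'

theorem biseparating_implies_strictly_biseparating
    {𝕜 : Type*} [RCLike 𝕜]
    {E₁ E₂ : Type*} [NormedAddCommGroup E₁] [NormedSpace 𝕜 E₁] [CompleteSpace E₁]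
    [Nontrivial E₁] [NormedAddCommGroup E₂] [NormedSpace 𝕜 E₂] [CompleteSpace E₂]
    [Nontrivial E₂]
    (𝒜₁ : Subalgebra 𝕜 (E₁ →L[𝕜] E₁)) (𝒜₂ : Subalgebra 𝕜 (E₂ →L[𝕜] E₂))
    (h𝒜₁ : IsStandardSubalgebra 𝕜 𝒜₁) (h𝒜₂ : IsStandardSubalgebra 𝕜 𝒜₂)
    {X₁ X₂ : Type*} [TopologicalSpace X₁] [CompletelyRegularSpace X₁] [T2Space X₁]
    [TopologicalSpace X₂] [CompletelyRegularSpace X₂] [T2Space X₂]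
    (T : C(X₁, 𝒜₁) →ₗ[𝕜] C(X₂, 𝒜₂)) (hbij : Function.Bijective T)
    (hsep : ∀ F G : C(X₁, 𝒜₁), F * G = 0 → T F * T G = 0)
    (hsep' : ∀ F G : C(X₁, 𝒜₁), T F * T G = 0 → F * G = 0) :
    ∀ F₁ F₂ : C(X₁, 𝒜₁),
      {x | F₁ x ≠ 0} ∩ {x | F₂ x ≠ 0} = ∅ ↔
        {x | T F₁ x ≠ 0} ∩ {x | T F₂ x ≠ 0} = ∅ := by
  intro F₁ F₂
  simp only [Set.eq_empty_iff_forall_notMem, Set.mem_inter_iff, Set.mem_ofPred_eq, not_and_or,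
    not_not]
  constructor
  · intro h y
    exact disjoint_map_aux 𝒜₁ 𝒜₂ h𝒜₂ T hbij.2 hsep hsep' F₁ F₂ h y
  · intro h x
    let e := LinearEquiv.ofBijective T hbij
    have he : ∀ G, T (e.symm G) = G := fun G => e.apply_symm_apply G
    have he' : ∀ G, e.symm (T G) = G := fun G => e.symm_apply_apply G
    have := disjoint_map_aux 𝒜₂ 𝒜₁ h𝒜₁ e.symm.toLinearMap e.symm.surjective
      (fun F G hFG => hsep' _ _ (by simpa [he] using hFG))
      (fun F G hFG => by simpa [he] using hsep _ _ hFG) (T F₁) (T F₂) h x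
    simpa [he'] using this
end
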